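/- arXiv:1405.5190 — 3 statements merged into one kernel-verified Lean document; each statement's English description precedes it below -/
import Mathlib

section
/- Let n ≥ 2 and let f : ℝ_{>0}^n → ℝ_{>0} be a quasi-sum production function, f(x_1,…,x_n) = G(h_1(x_1)+…+h_n(x_n)), where G and the h_j are twice differentiable strictly monotone real functions with G' > 0. Then the elasticity of production with respect to every factor x_i is a constant k_i (i.e. (x_i/f(x))·∂f/∂x_i(x) = k_i for all x and all i = 1,…,n) if and only if f reduces to a generalized Cobb–Douglas production function f(x_1,…,x_n) = A · ∏_{i=1}^n x_i^{α_i} for some constants A > 0 and α_1,…,α_n (with α_i = k_i). -/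
/-- Partial derivative of `f : ℝⁿ → ℝ` with respect to the `i`-th coordinate at `x`. -/
noncomputable def pd {n : ℕ} (f : (Fin n → ℝ) → ℝ) (i : Fin n) (x : Fin n → ℝ) : ℝ :=
  deriv (fun t => f (Function.update x i t)) (x i)

/-- A function that is unchanged by replacing any single coordinate by another positive value is
constant on the positive orthant. -/
lemma eq_of_update_invariant {ι β : Type*} [Fintype ι] [DecidableEq ι] {F : (ι → ℝ) → β}
    (hF : ∀ x : ι → ℝ, (∀ j, 0 < x j) → ∀ i t, 0 < t → F (Function.update x i t) = F x)
    {x y : ι → ℝ} (hx : ∀ j, 0 < x j) (hy : ∀ j, 0 < y j) : F x = F y := by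
  have key (s : Finset ι) : F (s.piecewise y x) = F x := by
    induction s using Finset.induction_on with
    | empty => simp
    | insert i s _ ih =>
      rw [Finset.piecewise_insert, hF _ _ i _ (hy i), ih]
      intro j
      by_cases hj : j ∈ s <;> simp [hj, hx, hy]
  simpa using (key Finset.univ).symm

/-- A positive function on `(0, ∞)` with constant elasticity `k` is a multiple of `t ^ k`. -/
lemma div_rpow_eq_of_elasticity_eq {g : ℝ → ℝ} {k : ℝ}
    (hg : ∀ t, 0 < t → DifferentiableAt ℝ g t) (hpos : ∀ t, 0 < t → 0 < g t)
    (hk : ∀ t, 0 < t → t / g t * deriv g t = k) {a b : ℝ} (ha : 0 < a) (hb : 0 < b) :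
    g a / a ^ k = g b / b ^ k := by
  have hderiv : ∀ t ∈ Set.Ioi (0 : ℝ), HasDerivAt (fun t => g t / t ^ k) 0 t := by
    intro t (ht : 0 < t)
    have hgt := (hpos t ht).ne'
    have hd := (hg t ht).hasDerivAt.div (Real.hasDerivAt_rpow_const (p := k) (Or.inl ht.ne'))
      (Real.rpow_pos_of_pos ht k).ne'
    refine hd.congr_deriv ?_
    have hE : t * deriv g t = k * g t := by
      rw [← hk t ht]
      field_simp
    rw [Real.rpow_sub_one ht.ne']
    field_simp
    linear_combination hE
  exact isOpen_Ioi.is_const_of_deriv_eq_zero isPreconnected_Ioi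
    (fun t ht => (hderiv t ht).differentiableAt.differentiableWithinAt)
    (fun t ht => (hderiv t ht).deriv) ha hb

lemma prod_update_rpow {ι : Type*} [Fintype ι] [DecidableEq ι] (k x : ι → ℝ) (i : ι) (t : ℝ) :
    ∏ j, Function.update x i t j ^ k j = t ^ k i * ∏ j ∈ Finset.univ.erase i, x j ^ k j := by
  rw [← Finset.mul_prod_erase _ _ (Finset.mem_univ i), Function.update_self]
  congr 1
  refine Finset.prod_congr rfl fun j hj => ?_
  rw [Function.update_of_ne (Finset.ne_of_mem_erase hj)]

lemma update_pos {ι : Type*} [DecidableEq ι] {x : ι → ℝ} (hx : ∀ j, 0 < x j) (i : ι) {t : ℝ}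
    (ht : 0 < t) (j : ι) : 0 < Function.update x i t j := by
  rcases eq_or_ne j i with rfl | hj
  · simpa using ht
  · simpa [hj] using hx j

/-- A quasi-sum production function has constant elasticity of production `kᵢ` with respect
to every factor `xᵢ` iff it reduces to the generalized Cobb–Douglas production function
`f(x) = A · ∏ᵢ xᵢ^{kᵢ}` with `A > 0`. -/
theorem quasiSum_constant_elasticity_all_iff_cobbDouglas
    (n : ℕ) (hn : 2 ≤ n)
    (G : ℝ → ℝ) (h : Fin n → ℝ → ℝ) (f : (Fin n → ℝ) → ℝ)
    (hf : ∀ x : Fin n → ℝ, (∀ j, 0 < x j) → f x = G (∑ j, h j (x j)))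
    (hfpos : ∀ x : Fin n → ℝ, (∀ j, 0 < x j) → 0 < f x)
    (hGdiff : Differentiable ℝ G)
    (hGdiff2 : Differentiable ℝ (deriv G))
    (hGmono : StrictMono G)
    (hG' : ∀ u : ℝ, 0 < deriv G u)
    (hhdiff : ∀ j, ∀ t : ℝ, 0 < t → DifferentiableAt ℝ (h j) t)
    (hhdiff2 : ∀ j, ∀ t : ℝ, 0 < t → DifferentiableAt ℝ (deriv (h j)) t)
    (hhmono : ∀ j, StrictMonoOn (h j) (Set.Ioi 0) ∨ StrictAntiOn (h j) (Set.Ioi 0))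
    (k : Fin n → ℝ) :
    (∀ i : Fin n, ∀ x : Fin n → ℝ, (∀ j, 0 < x j) → (x i / f x) * pd f i x = k i)
      ↔ ∃ A : ℝ, 0 < A ∧ ∀ x : Fin n → ℝ, (∀ j, 0 < x j) →
          f x = A * ∏ i, (x i) ^ (k i) := by
  constructor
  · intro hE
    have hP (x : Fin n → ℝ) (hx : ∀ j, 0 < x j) : 0 < ∏ i, x i ^ k i :=
      Finset.prod_pos fun i _ => Real.rpow_pos_of_pos (hx i) _
    have hinv : ∀ x : Fin n → ℝ, (∀ j, 0 < x j) → ∀ i t, 0 < t →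
        f (Function.update x i t) / ∏ j, Function.update x i t j ^ k j
          = f x / ∏ j, x j ^ k j := by
      intro x hx i t ht
      have hdiff (s : ℝ) (hs : 0 < s) :
          DifferentiableAt ℝ (fun s => f (Function.update x i s)) s := by
        have hG : DifferentiableAt ℝ
            (fun s => G (∑ j, h j (Function.update x i s j))) s := by
          refine (hGdiff _).comp s (DifferentiableAt.fun_sum fun j _ => ?_)
          rcases eq_or_ne j i with rfl | hj
          · simpa using hhdiff j s hs
          · simp [hj]
        refine hG.congr_of_eventuallyEq ?_
        filter_upwards [Ioi_mem_nhds hs] with r hr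
        exact hf _ (update_pos hx i hr)
      have hslice := div_rpow_eq_of_elasticity_eq hdiff
        (fun s hs => hfpos _ (update_pos hx i hs)) (k := k i)
        (fun s hs => by simpa [pd] using hE i _ (update_pos hx i hs)) ht (hx i)
      rw [Function.update_eq_self] at hslice
      rw [prod_update_rpow, ← Finset.mul_prod_erase _ _ (Finset.mem_univ i), ← div_div,
        hslice, div_div]
    have h1 : ∀ j : Fin n, 0 < (1 : Fin n → ℝ) j := fun _ => one_pos
    refine ⟨f 1, hfpos 1 h1, fun x hx => ?_⟩
    have hc := eq_of_update_invariant (F := fun x => f x / ∏ j, x j ^ k j) hinv hx h1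
    simp only [Pi.one_apply, Real.one_rpow, Finset.prod_const_one, div_one] at hc
    exact (div_eq_iff (hP x hx).ne').mp hc
  · rintro ⟨A, hA, hfA⟩ i x hx
    set C := ∏ j ∈ Finset.univ.erase i, x j ^ k j with hC
    have hCpos : 0 < C := Finset.prod_pos fun j _ => Real.rpow_pos_of_pos (hx j) _
    have hslice : (fun t => f (Function.update x i t)) =ᶠ[nhds (x i)]
        fun t => A * (t ^ k i * C) := by
      filter_upwards [Ioi_mem_nhds (hx i)] with t ht
      rw [hfA _ (update_pos hx i ht), prod_update_rpow]
    have hd := ((Real.hasDerivAt_rpow_const (p := k i)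
      (Or.inl (hx i).ne')).mul_const C).const_mul A
    have hxk := Real.rpow_pos_of_pos (hx i) (k i)
    have hxi := (hx i).ne'
    rw [pd, hslice.deriv_eq, hd.deriv, hfA x hx,
      ← Finset.mul_prod_erase _ _ (Finset.mem_univ i), ← hC, Real.rpow_sub_one hxi]
    field_simp
end

section
/- Let n ≥ 2 and let f : ℝ_{>0}^n → ℝ_{>0} be a quasi-sum production function, f(x_1,…,x_n) = G(h_1(x_1)+…+h_n(x_n)), where G and the h_j are twice differentiable strictly monotone real functions with G' > 0. Then f satisfies the proportional marginal rate of substitution property (i.e. (∂f/∂x_j)/(∂f/∂x_i) = x_i/x_j for all i ≠ j and all x) if and only if there exist a nonzero real number k and a strictly monotone function F such that f(x_1,…,x_n) = F(∏_{i=1}^n x_i^k), i.e. f is a homothetic generalized Cobb–Douglas production function. -/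
lemma pd_quasiSum {n : ℕ} {G : ℝ → ℝ} {h : Fin n → ℝ → ℝ} {f : (Fin n → ℝ) → ℝ}
    (hf : ∀ x : Fin n → ℝ, (∀ j, 0 < x j) → f x = G (∑ j, h j (x j)))
    (hG : Differentiable ℝ G)
    (hh : ∀ j, ∀ t : ℝ, 0 < t → DifferentiableAt ℝ (h j) t)
    {x : Fin n → ℝ} (hx : ∀ j, 0 < x j) (i : Fin n) :
    pd f i x = deriv G (∑ j, h j (x j)) * deriv (h i) (x i) := by
  have hsum : ∀ t, ∑ j, h j (Function.update x i t j)
      = h i t + ∑ j ∈ Finset.univ \ {i}, h j (x j) := by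
    intro t
    simp_rw [Function.apply_update h x i t]
    exact Finset.sum_update_of_mem (Finset.mem_univ i) _ _
  have hSx : h i (x i) + ∑ j ∈ Finset.univ \ {i}, h j (x j) = ∑ j, h j (x j) := by
    rw [← hsum, Function.update_eq_self]
  have heq : (fun t => f (Function.update x i t)) =ᶠ[nhds (x i)]
      fun t => G (h i t + ∑ j ∈ Finset.univ \ {i}, h j (x j)) := by
    filter_upwards [lt_mem_nhds (hx i)] with t ht
    rw [hf _ fun j => ?_, hsum]
    rcases eq_or_ne j i with rfl | hj
    · simpa using ht
    · simpa [hj] using hx j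
  rw [pd, heq.deriv_eq]
  have h1 := ((hh i _ (hx i)).hasDerivAt.add_const (∑ j ∈ Finset.univ \ {i}, h j (x j)))
  have h2 := (hG (h i (x i) + ∑ j ∈ Finset.univ \ {i}, h j (x j))).hasDerivAt
  rw [← hSx]
  exact (h2.comp (x i) h1).deriv

/-- If `t * h'(t)` is the constant `c` on the positive reals, then `h` is `c * log` up to an
additive constant. -/
lemma eq_mul_log_add_of_mul_deriv_eq {h : ℝ → ℝ} {c : ℝ}
    (hh : ∀ t : ℝ, 0 < t → DifferentiableAt ℝ h t)
    (hc : ∀ t : ℝ, 0 < t → t * deriv h t = c) {t : ℝ} (ht : 0 < t) :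
    h t = c * Real.log t + h 1 := by
  have hd : ∀ s ∈ Set.Ioi (0 : ℝ), HasDerivAt (fun s => h s - c * Real.log s) 0 s := by
    intro s hs
    have hs0 : s ≠ 0 := ne_of_gt hs
    refine ((hh s hs).hasDerivAt.sub ((Real.hasDerivAt_log hs0).const_mul c)).congr_deriv ?_
    rw [← hc s hs]
    field_simp
    ring
  have := isOpen_Ioi.is_const_of_deriv_eq_zero isPreconnected_Ioi
    (fun s hs => (hd s hs).differentiableAt.differentiableWithinAt)
    (fun s hs => (hd s hs).deriv) (Set.mem_Ioi.2 ht) (Set.mem_Ioi.2 one_pos)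
  simp only [Real.log_one] at this
  linarith

/-- If `t * hᵢ'(t)` agrees for different indices at all pairs of positive points, it is a
constant independent of the index. -/
lemma exists_mul_deriv_eq {n : ℕ} (hn : 2 ≤ n) {h : Fin n → ℝ → ℝ}
    (H : ∀ i j : Fin n, i ≠ j → ∀ s t : ℝ, 0 < s → 0 < t →
      s * deriv (h i) s = t * deriv (h j) t) :
    ∃ c : ℝ, ∀ i, ∀ t : ℝ, 0 < t → t * deriv (h i) t = c := by
  have : Nontrivial (Fin n) := Fin.nontrivial_iff_two_le.2 hn
  obtain ⟨a, b, hab⟩ := exists_pair_ne (Fin n)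
  refine ⟨1 * deriv (h a) 1, fun i t ht => ?_⟩
  rcases eq_or_ne i a with rfl | hi
  · exact (H i b hab t 1 ht one_pos).trans (H i b hab 1 1 one_pos one_pos).symm
  · exact H i a hi t 1 ht one_pos

/-- If `p a + q b` is constant along the hyperbola `a * b = s * t`, then the derivatives of `p` at `s`
and of `q` at `t` with respect to the logarithm of the argument agree. -/
lemma mul_deriv_eq_of_add_eq {p q : ℝ → ℝ} {s t : ℝ} (hs : 0 < s) (ht : 0 < t)
    (hp : DifferentiableAt ℝ p s) (hq : DifferentiableAt ℝ q t)
    (H : ∀ a b : ℝ, 0 < a → 0 < b → a * b = s * t → p a + q b = p s + q t) :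
    s * deriv p s = t * deriv q t := by
  have hu : HasDerivAt (fun u : ℝ => s * Real.exp u) s 0 := by
    simpa using (Real.hasDerivAt_exp 0).const_mul s
  have hv : HasDerivAt (fun u : ℝ => t * Real.exp (-u)) (-t) 0 := by
    simpa using ((hasDerivAt_neg (0 : ℝ)).exp).const_mul t
  have hp' : HasDerivAt p (deriv p s) (s * Real.exp 0) := by simpa using hp.hasDerivAt
  have hq' : HasDerivAt q (deriv q t) (t * Real.exp (-0)) := by simpa using hq.hasDerivAt
  have hsum := (hp'.comp 0 hu).add (hq'.comp 0 hv)
  have hconst : (p ∘ fun u : ℝ => s * Real.exp u) + (q ∘ fun u : ℝ => t * Real.exp (-u))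
      = fun _ => p s + q t := by
    funext u
    refine H _ _ (by positivity) (by positivity) ?_
    rw [mul_mul_mul_comm, ← Real.exp_add]
    simp
  rw [hconst] at hsum
  linarith [hsum.unique (hasDerivAt_const 0 (p s + q t))]

/-- For a quasi-sum production function, the proportional marginal rate of substitution property
says that `t * hᵢ'(t)` is a nonzero constant independent of `i`. -/
lemma proportionalMRS_iff_exists_mul_deriv_eq {n : ℕ} (hn : 2 ≤ n)
    {G : ℝ → ℝ} {h : Fin n → ℝ → ℝ} {f : (Fin n → ℝ) → ℝ}
    (hf : ∀ x : Fin n → ℝ, (∀ j, 0 < x j) → f x = G (∑ j, h j (x j)))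
    (hG : Differentiable ℝ G) (hG' : ∀ u : ℝ, 0 < deriv G u)
    (hh : ∀ j, ∀ t : ℝ, 0 < t → DifferentiableAt ℝ (h j) t) :
    (∀ x : Fin n → ℝ, (∀ j, 0 < x j) → ∀ i j : Fin n, i ≠ j →
        pd f j x / pd f i x = x i / x j)
      ↔ ∃ c : ℝ, c ≠ 0 ∧ ∀ i, ∀ t : ℝ, 0 < t → t * deriv (h i) t = c := by
  have hpd : ∀ x : Fin n → ℝ, (∀ j, 0 < x j) → ∀ i j : Fin n,
      pd f j x / pd f i x = deriv (h j) (x j) / deriv (h i) (x i) := fun x hx i j => by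
    rw [pd_quasiSum hf hG hh hx, pd_quasiSum hf hG hh hx, mul_div_mul_left _ _ (hG' _).ne']
  constructor
  · intro H
    have key : ∀ i j : Fin n, i ≠ j → ∀ s t : ℝ, 0 < s → 0 < t →
        deriv (h j) t / deriv (h i) s = s / t := by
      intro i j hij s t hs ht
      have hx : ∀ l, 0 < Function.update (fun _ : Fin n => t) i s l := fun l => by
        rcases eq_or_ne l i with rfl | hl
        · simpa using hs
        · simpa [hl] using ht
      have := H _ hx i j hij
      rw [hpd _ hx] at this
      simpa [hij.symm] using this
    have hne : ∀ i j : Fin n, i ≠ j → ∀ s : ℝ, 0 < s → deriv (h i) s ≠ 0 := by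
      intro i j hij s hs h0
      have := key i j hij s s hs hs
      rw [h0, div_zero, div_self hs.ne'] at this
      exact zero_ne_one this
    obtain ⟨c, hc⟩ := exists_mul_deriv_eq hn (h := h) fun i j hij s t hs ht => by
      have := key i j hij s t hs ht
      rw [div_eq_div_iff (hne i j hij s hs) ht.ne'] at this
      linarith
    refine ⟨c, ?_, hc⟩
    have : Nontrivial (Fin n) := Fin.nontrivial_iff_two_le.2 hn
    obtain ⟨a, b, hab⟩ := exists_pair_ne (Fin n)
    rw [← hc a 1 one_pos]
    exact mul_ne_zero one_ne_zero (hne a b hab 1 one_pos)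
  · rintro ⟨c, hc0, hc⟩ x hx i j -
    have hi := hc i _ (hx i)
    have hj := hc j _ (hx j)
    have hi0 : deriv (h i) (x i) ≠ 0 := right_ne_zero_of_mul (hi.trans_ne hc0)
    rw [hpd x hx, div_eq_div_iff hi0 (hx j).ne']
    linarith

/-- A quasi-sum production function satisfies the proportional marginal rate of substitution
property `MRS_{ij} = xᵢ/xⱼ` iff it reduces to a homothetic generalized Cobb–Douglas
production function `f(x) = F(∏ᵢ xᵢᵏ)` for some nonzero `k` and strictly monotone `F`. -/
theorem quasiSum_proportionalMRS_iff_homotheticCobbDouglas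
    (n : ℕ) (hn : 2 ≤ n)
    (G : ℝ → ℝ) (h : Fin n → ℝ → ℝ) (f : (Fin n → ℝ) → ℝ)
    (hf : ∀ x : Fin n → ℝ, (∀ j, 0 < x j) → f x = G (∑ j, h j (x j)))
    (hfpos : ∀ x : Fin n → ℝ, (∀ j, 0 < x j) → 0 < f x)
    (hGdiff : Differentiable ℝ G)
    (hGdiff2 : Differentiable ℝ (deriv G))
    (hGmono : StrictMono G)
    (hG' : ∀ u : ℝ, 0 < deriv G u)
    (hhdiff : ∀ j, ∀ t : ℝ, 0 < t → DifferentiableAt ℝ (h j) t)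
    (hhdiff2 : ∀ j, ∀ t : ℝ, 0 < t → DifferentiableAt ℝ (deriv (h j)) t)
    (hhmono : ∀ j, StrictMonoOn (h j) (Set.Ioi 0) ∨ StrictAntiOn (h j) (Set.Ioi 0)) :
    (∀ x : Fin n → ℝ, (∀ j, 0 < x j) → ∀ i j : Fin n, i ≠ j →
        pd f j x / pd f i x = x i / x j)
      ↔ ∃ k : ℝ, k ≠ 0 ∧ ∃ F : ℝ → ℝ,
          (StrictMonoOn F (Set.Ioi 0) ∨ StrictAntiOn F (Set.Ioi 0)) ∧
          ∀ x : Fin n → ℝ, (∀ j, 0 < x j) → f x = F (∏ i, (x i) ^ k) := by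
  rw [proportionalMRS_iff_exists_mul_deriv_eq hn hf hGdiff hG' hhdiff]
  constructor
  · rintro ⟨c, hc0, hc⟩
    refine ⟨1, one_ne_zero, fun u => G (c * Real.log u + ∑ j, h j 1), ?_, fun x hx => ?_⟩
    · rcases hc0.lt_or_gt with hneg | hpos
      · refine Or.inr fun u hu v _ huv => hGmono ?_
        have := mul_lt_mul_of_neg_left (Real.log_lt_log hu huv) hneg
        linarith
      · refine Or.inl fun u hu v _ huv => hGmono ?_
        have := mul_lt_mul_of_pos_left (Real.log_lt_log hu huv) hpos
        linarith
    · simp only [Real.rpow_one]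
      rw [hf x hx, Real.log_prod fun j _ => (hx j).ne', Finset.mul_sum,
        ← Finset.sum_add_distrib]
      exact congrArg G (Finset.sum_congr rfl fun j _ =>
        eq_mul_log_add_of_mul_deriv_eq (hhdiff j) (hc j) (hx j))
  · rintro ⟨k, -, F, -, hF⟩
    obtain ⟨c, hc⟩ := exists_mul_deriv_eq hn (h := h) fun i j hij s t hs ht => by
      refine mul_deriv_eq_of_add_eq hs ht (hhdiff i s hs) (hhdiff j t ht) fun a b ha hb hab => ?_
      have hi : i ∈ Finset.univ \ {j} := by simp [hij]
      have hval : ∀ a b : ℝ, 0 < a → 0 < b →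
          G (h j b + (h i a + ∑ l ∈ (Finset.univ \ {j}) \ {i}, h l 1)) = F ((a * b) ^ k) := by
        intro a b ha hb
        have hx : ∀ l, 0 < Function.update (Function.update (fun _ : Fin n => (1 : ℝ)) i a) j b l := by
          intro l
          simp only [Function.update_apply]
          split_ifs <;> first | assumption | exact one_pos
        have hfx := hf _ hx
        rw [hF _ hx, Real.finsetProd_rpow _ _ (fun l _ => (hx l).le),
          Finset.prod_update_of_mem (Finset.mem_univ j), Finset.prod_update_of_mem hi] at hfx
        simp_rw [Function.apply_update h] at hfx
        rw [Finset.sum_update_of_mem (Finset.mem_univ j), Finset.sum_update_of_mem hi] at hfx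
        rw [← hfx, Finset.prod_const_one, mul_one, mul_comm]
      have := hGmono.injective ((hval a b ha hb).trans (hab ▸ (hval s t hs ht).symm))
      linarith
    refine ⟨c, ?_, hc⟩
    rintro rfl
    have i : Fin n := ⟨0, by omega⟩
    have h21 : h i 2 = h i 1 := by
      simpa using eq_mul_log_add_of_mul_deriv_eq (hhdiff i) (hc i) (two_pos : (0 : ℝ) < 2)
    have hinj : Set.InjOn (h i) (Set.Ioi 0) := (hhmono i).elim (·.injOn) (·.injOn)
    have := hinj (Set.mem_Ioi.2 two_pos) (Set.mem_Ioi.2 one_pos) h21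
    norm_num at this
end

section
/- Let n ≥ 2 and let f : ℝ_{>0}^n → ℝ_{>0} be a quasi-sum production function, f(x_1,…,x_n) = G(h_1(x_1)+…+h_n(x_n)), where G and the h_j are twice differentiable strictly monotone real functions with G' > 0, and suppose f satisfies the proportional marginal rate of substitution property. Then f cannot satisfy the minimal hypersurface equation; that is, it is impossible that Σ_{i=1}^n ∂²f/∂x_i² · (1 + Σ_{i=1}^n (∂f/∂x_i)²) − Σ_{i,j=1}^n (∂f/∂x_i)(∂f/∂x_j)(∂²f/∂x_i∂x_j) = 0 holds identically on ℝ_{>0}^n. Equivalently, the production hypersurface {(x, f(x))} ⊂ ℝ^{n+1} cannot be minimal. -/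
/-- Second partial derivative `∂²f/∂xⱼ∂xᵢ` at `x`. -/
noncomputable def pd2 {n : ℕ} (f : (Fin n → ℝ) → ℝ) (i j : Fin n) (x : Fin n → ℝ) : ℝ :=
  pd (pd f i) j x

open Filter Topology

theorem eventually_update_pos {n : ℕ} {x : Fin n → ℝ} (hx : ∀ j, 0 < x j) (i : Fin n) :
    ∀ᶠ t in 𝓝 (x i), ∀ j, 0 < Function.update x i t j := by
  filter_upwards [lt_mem_nhds (hx i)] with t ht j
  by_cases hj : j = i
  · subst hj
    simpa using ht
  · simpa [hj] using hx j

/-- The partial derivative at a point of the positive orthant only depends on the values of the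
function on the positive orthant. -/
theorem pd_eq_of_hasDerivAt {n : ℕ} {f g : (Fin n → ℝ) → ℝ} {i : Fin n} {x : Fin n → ℝ} {d : ℝ}
    (hfg : ∀ y : Fin n → ℝ, (∀ j, 0 < y j) → f y = g y) (hx : ∀ j, 0 < x j)
    (hg : HasDerivAt (fun t => g (Function.update x i t)) d (x i)) : pd f i x = d := by
  refine (hg.congr_of_eventuallyEq ?_).deriv
  filter_upwards [eventually_update_pos hx i] with t ht using hfg _ ht

theorem hasDerivAt_sum_update {n : ℕ} {h : Fin n → ℝ → ℝ} {x : Fin n → ℝ} (i : Fin n)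
    (hd : DifferentiableAt ℝ (h i) (x i)) :
    HasDerivAt (fun t => ∑ j, h j (Function.update x i t j)) (deriv (h i) (x i)) (x i) := by
  have key : (fun t => ∑ j, h j (Function.update x i t j)) =
      fun t => h i t + ∑ j ∈ Finset.univ.erase i, h j (x j) := by
    funext t
    rw [← Finset.add_sum_erase _ _ (Finset.mem_univ i), Function.update_self]
    congr 1
    refine Finset.sum_congr rfl fun j hj => ?_
    rw [Function.update_of_ne (Finset.ne_of_mem_erase hj)]
  rw [key]
  exact hd.hasDerivAt.add_const _

theorem hasDerivAt_comp_sum_update {n : ℕ} {G : ℝ → ℝ} {h : Fin n → ℝ → ℝ} {x : Fin n → ℝ}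
    (i : Fin n) (hG : Differentiable ℝ G) (hd : DifferentiableAt ℝ (h i) (x i)) :
    HasDerivAt (fun t => G (∑ j, h j (Function.update x i t j)))
      (deriv G (∑ j, h j (x j)) * deriv (h i) (x i)) (x i) := by
  refine HasDerivAt.comp (h₂ := G) (x i) ?_ (hasDerivAt_sum_update i hd)
  rw [Function.update_eq_self]
  exact (hG _).hasDerivAt

/-- If `t * φ'(t)` is constant on the positive half-line, then `φ` is affine in `log t`. -/
theorem eq_mul_log_add_of_deriv_mul_eq {φ : ℝ → ℝ} {c : ℝ}
    (hd : ∀ t, 0 < t → DifferentiableAt ℝ φ t) (hc : ∀ t, 0 < t → deriv φ t = c / t)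
    {t : ℝ} (ht : 0 < t) : φ t = c * Real.log t + φ 1 := by
  have hder : ∀ s ∈ Set.Ioi (0 : ℝ), HasDerivAt (fun s => φ s - c * Real.log s) 0 s := by
    intro s hs
    refine ((hd s hs).hasDerivAt.sub
      ((Real.hasDerivAt_log (ne_of_gt hs)).const_mul c)).congr_deriv ?_
    rw [hc s hs]
    ring
  have := isOpen_Ioi.is_const_of_deriv_eq_zero isPreconnected_Ioi
    (fun s hs => (hder s hs).differentiableAt.differentiableWithinAt)
    (fun s hs => (hder s hs).deriv) (Set.mem_Ioi.2 ht) (Set.mem_Ioi.2 one_pos)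
  simp only [Real.log_one, mul_zero, sub_zero] at this
  linarith

/-- If all ratios `φ j (x j) / φ i (x i)` equal `x i / x j`, then every `φ j` is `c / t` on the
positive half-line, with one and the same constant `c ≠ 0`. -/
theorem exists_eq_div_of_ratio {m : ℕ} {φ : Fin (m + 2) → ℝ → ℝ}
    (hr : ∀ x : Fin (m + 2) → ℝ, (∀ j, 0 < x j) → ∀ i j, i ≠ j →
      φ j (x j) / φ i (x i) = x i / x j) :
    ∃ c : ℝ, c ≠ 0 ∧ ∀ j t, 0 < t → φ j t = c / t := by
  have hne : ∀ i j, i ≠ j → ∀ s t : ℝ, 0 < s → 0 < t → φ i s ≠ 0 ∧ φ j t * t = φ i s * s := by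
    intro i j hij s t hs ht
    have h1 := hr (fun k => if k = i then s else t) (fun k => by split_ifs <;> assumption) i j hij
    simp only [if_true, if_neg hij.symm] at h1
    have h0 : φ i s ≠ 0 := by
      intro h0
      rw [h0, div_zero] at h1
      exact (div_pos hs ht).ne h1
    refine ⟨h0, ?_⟩
    rw [div_eq_div_iff h0 ht.ne'] at h1
    linarith
  have h01 : (0 : Fin (m + 2)) ≠ 1 := by simp
  refine ⟨φ 0 1, (hne 0 1 h01 1 1 one_pos one_pos).1, fun j t ht => ?_⟩
  rw [eq_div_iff ht.ne']
  by_cases hj : j = 0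
  · subst hj
    have h1 := (hne 1 0 h01.symm 1 t one_pos ht).2
    have h2 := (hne 0 1 h01 1 1 one_pos one_pos).2
    linarith
  · have := (hne 0 j (Ne.symm hj) 1 t one_pos ht).2
    linarith

/-- The left-hand side of the minimal hypersurface equation for a function with gradient
`a / xᵢ` and Hessian `b / (xᵢ xⱼ) - δᵢⱼ a / xᵢ²`, where `y = 1 / x`. -/
theorem minimal_expression_eq {n : ℕ} (a b : ℝ) (y : Fin n → ℝ) :
    (∑ i, (b * y i * y i - if i = i then a * y i ^ 2 else 0)) * (1 + ∑ i, (a * y i) ^ 2)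
        - ∑ i, ∑ j, a * y i * (a * y j) * (b * y i * y j - if i = j then a * y i ^ 2 else 0)
      = (b - a) * ∑ i, y i ^ 2 - a ^ 3 * ((∑ i, y i ^ 2) ^ 2 - ∑ i, y i ^ 4) := by
  have h1 : ∑ i, (b * y i * y i - if i = i then a * y i ^ 2 else 0)
      = (b - a) * ∑ i, y i ^ 2 := by
    rw [Finset.mul_sum]
    refine Finset.sum_congr rfl fun i _ => ?_
    rw [if_pos rfl]
    ring
  have h2 : ∑ i, (a * y i) ^ 2 = a ^ 2 * ∑ i, y i ^ 2 := by
    simp only [mul_pow, Finset.mul_sum]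
  have h3 : ∑ i, ∑ j, a * y i * (a * y j) * (b * y i * y j - if i = j then a * y i ^ 2 else 0)
      = a ^ 2 * b * (∑ i, y i ^ 2) ^ 2 - a ^ 3 * ∑ i, y i ^ 4 := by
    rw [sq (∑ i, y i ^ 2), Finset.sum_mul_sum, Finset.mul_sum, Finset.mul_sum,
      ← Finset.sum_sub_distrib]
    refine Finset.sum_congr rfl fun i _ => ?_
    simp only [mul_sub, Finset.sum_sub_distrib, mul_ite, mul_zero, Finset.sum_ite_eq,
      Finset.mem_univ, if_true, Finset.mul_sum]
    congr 1
    · exact Finset.sum_congr rfl fun j _ => by ring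
    · ring
  rw [h1, h2, h3]
  ring

/-- A quasi-sum production function satisfying the proportional marginal rate of
substitution property cannot satisfy the minimal hypersurface equation; i.e. the
production hypersurface cannot be minimal. -/
theorem quasiSum_proportionalMRS_not_minimal
    (n : ℕ) (hn : 2 ≤ n)
    (G : ℝ → ℝ) (h : Fin n → ℝ → ℝ) (f : (Fin n → ℝ) → ℝ)
    (hf : ∀ x : Fin n → ℝ, (∀ j, 0 < x j) → f x = G (∑ j, h j (x j)))
    (hfpos : ∀ x : Fin n → ℝ, (∀ j, 0 < x j) → 0 < f x)
    (hGdiff : Differentiable ℝ G)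
    (hGdiff2 : Differentiable ℝ (deriv G))
    (hGmono : StrictMono G)
    (hG' : ∀ u : ℝ, 0 < deriv G u)
    (hhdiff : ∀ j, ∀ t : ℝ, 0 < t → DifferentiableAt ℝ (h j) t)
    (hhdiff2 : ∀ j, ∀ t : ℝ, 0 < t → DifferentiableAt ℝ (deriv (h j)) t)
    (hhmono : ∀ j, StrictMonoOn (h j) (Set.Ioi 0) ∨ StrictAntiOn (h j) (Set.Ioi 0))
    (hMRS : ∀ x : Fin n → ℝ, (∀ j, 0 < x j) → ∀ i j : Fin n, i ≠ j →
        pd f j x / pd f i x = x i / x j) :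
    ¬ (∀ x : Fin n → ℝ, (∀ j, 0 < x j) →
        (∑ i, pd2 f i i x) * (1 + ∑ i, (pd f i x) ^ 2)
          - ∑ i, ∑ j, pd f i x * pd f j x * pd2 f i j x = 0) := by
  obtain ⟨m, rfl⟩ : ∃ m, n = m + 2 := ⟨n - 2, by omega⟩
  intro hmin
  have hpd0 : ∀ i x, (∀ j, 0 < x j) →
      pd f i x = deriv G (∑ j, h j (x j)) * deriv (h i) (x i) := fun i x hx =>
    pd_eq_of_hasDerivAt hf hx (hasDerivAt_comp_sum_update i hGdiff (hhdiff i _ (hx i)))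
  obtain ⟨c, hc0, hc⟩ := exists_eq_div_of_ratio (φ := fun j => deriv (h j))
    fun x hx i j hij => by
      rw [← hMRS x hx i j hij, hpd0 i x hx, hpd0 j x hx, mul_div_mul_left _ _ (hG' _).ne']
  have hpd : ∀ i x, (∀ j, 0 < x j) →
      pd f i x = deriv G (∑ j, h j (x j)) * (c * (x i)⁻¹) := fun i x hx => by
    rw [hpd0 i x hx, hc i _ (hx i), div_eq_mul_inv]
  have hpd2 : ∀ i j x, (∀ k, 0 < x k) → pd2 f i j x =
      deriv (deriv G) (∑ k, h k (x k)) * c ^ 2 * (x i)⁻¹ * (x j)⁻¹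
        - if i = j then deriv G (∑ k, h k (x k)) * c * (x i)⁻¹ ^ 2 else 0 := by
    intro i j x hx
    refine pd_eq_of_hasDerivAt (hpd i) hx ?_
    have h1 := hasDerivAt_comp_sum_update j hGdiff2 (hhdiff j _ (hx j))
    by_cases hij : i = j
    · subst hij
      have h2 := h1.mul ((hasDerivAt_inv (hx i).ne').const_mul c)
      simp only [Function.update_self, if_true]
      refine h2.congr_deriv ?_
      simp only [Function.update_eq_self, hc i _ (hx i)]
      field_simp
      ring
    · have h2 := h1.mul_const (c * (x i)⁻¹)
      simp only [Function.update_of_ne hij, if_neg hij, sub_zero]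
      refine h2.congr_deriv ?_
      rw [hc j _ (hx j)]
      ring
  have hred : ∀ x : Fin (m + 2) → ℝ, (∀ j, 0 < x j) →
      (deriv (deriv G) (∑ k, h k (x k)) * c ^ 2 - deriv G (∑ k, h k (x k)) * c)
          * ∑ i, (x i)⁻¹ ^ 2
        - (deriv G (∑ k, h k (x k)) * c) ^ 3
          * ((∑ i, (x i)⁻¹ ^ 2) ^ 2 - ∑ i, (x i)⁻¹ ^ 4) = 0 := by
    intro x hx
    have h1 := hmin x hx
    simp only [hpd _ x hx, hpd2 _ _ x hx, ← mul_assoc] at h1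
    rw [← minimal_expression_eq _ _ fun i => (x i)⁻¹]
    simpa only [← mul_assoc] using h1
  let p : ℝ → Fin (m + 2) → ℝ := fun t => Fin.cons t (Fin.cons t⁻¹ fun _ => 2⁻¹)
  have hp : ∀ t, 0 < t → ∀ j, 0 < p t j := fun t ht => by
    simp [p, Fin.forall_fin_succ, ht]
  have hlevel : ∑ k, h k (p 2 k) = ∑ k, h k (p 1 k) := by
    have h0 := eq_mul_log_add_of_deriv_mul_eq (hhdiff 0) (hc 0) (t := 2) two_pos
    have h1 := eq_mul_log_add_of_deriv_mul_eq (hhdiff 1) (hc 1) (t := 2⁻¹) (by norm_num)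
    rw [Real.log_inv] at h1
    simp [p, Fin.sum_univ_succ]
    linarith
  have e1 := hred (p 1) (hp 1 one_pos)
  have e2 := hred (p 2) (hp 2 two_pos)
  rw [hlevel] at e2
  have ha : (deriv G (∑ k, h k (p 1 k)) * c) ^ 3 ≠ 0 := pow_ne_zero _ (mul_ne_zero (hG' _).ne' hc0)
  generalize (deriv G (∑ k, h k (p 1 k)) * c) ^ 3 = A at e1 e2 ha
  generalize deriv (deriv G) _ * c ^ 2 - deriv G _ * c = B at e1 e2
  simp [p, Fin.sum_univ_succ] at e1 e2
  norm_num at e1 e2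
  have hm : A * (1 - 8 * m * (m + 1) : ℝ) = 0 := by
    linear_combination (2 / 9 : ℝ) * ((2 + 4 * m) * e2 - (17 / 4 + 4 * m) * e1)
  have hm' : (1 : ℝ) - 8 * m * (m + 1) = 0 := (mul_eq_zero.1 hm).resolve_left ha
  have hnat : 8 * m * (m + 1) = 1 := by
    exact_mod_cast (sub_eq_zero.1 hm').symm
  rw [mul_assoc] at hnat
  omega
end
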